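/- arXiv:1312.4244 — 3 statements merged into one kernel-verified Lean document; each statement's English description precedes it below -/
import Mathlib

section
/- For every càdlàg function f : [0,∞) → ℝ there exists a unique càdlàg function x : [0,∞) → ℝ satisfying the integral equation x(t) = f(t) − ∫₀ᵗ x(u)⁺ du for all t ≥ 0. -/
open MeasureTheory Set Filter

/-- A real function is càdlàg on `[0, ∞)` if it is right-continuous at every `t ≥ 0`
and has a finite left limit (within `[0, t)`) at every `t > 0`. -/
def IsCadlag (f : ℝ → ℝ) : Prop :=
  (∀ t : ℝ, 0 ≤ t → ContinuousWithinAt f (Set.Ici t) t) ∧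
  (∀ t : ℝ, 0 < t → ∃ l : ℝ, Filter.Tendsto f (nhdsWithin t (Set.Ico 0 t)) (nhds l))

lemma cadlag_aesm (f : ℝ → ℝ) (hf : IsCadlag f) :
    Measurable (fun t => f (max t 0)) := by
  refine measurable_of_tendsto_metrizable
    (f := fun (n : ℕ) t => f (((⌊((n:ℝ)+1) * max t 0⌋₊ : ℝ) + 1) / ((n:ℝ)+1))) ?_ ?_
  · intro n
    have h1 : Measurable (fun k : ℕ => f (((k : ℝ) + 1) / ((n:ℝ)+1))) := measurable_of_countable _
    have h2 : Measurable (fun t : ℝ => ⌊((n:ℝ)+1) * max t 0⌋₊) := by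
      apply Nat.measurable_floor.comp
      fun_prop
    exact h1.comp h2
  · rw [tendsto_pi_nhds]
    intro t
    have h0 : 0 ≤ max t 0 := le_max_right _ _
    generalize max t 0 = s at h0
    refine (hf.1 s h0).tendsto.comp ?_
    have hn : ∀ n : ℕ, (0:ℝ) < (n:ℝ)+1 := fun n => by positivity
    have hlo : ∀ n : ℕ, s ≤ ((⌊((n:ℝ)+1) * s⌋₊ : ℝ) + 1) / ((n:ℝ)+1) := by
      intro n
      rw [le_div_iff₀ (hn n)]
      have := Nat.lt_floor_add_one (((n:ℝ)+1) * s)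
      linarith
    have hhi : ∀ n : ℕ, ((⌊((n:ℝ)+1) * s⌋₊ : ℝ) + 1) / ((n:ℝ)+1) ≤ s + 1 / ((n:ℝ)+1) := by
      intro n
      have e : (s + 1 / ((n:ℝ)+1)) * ((n:ℝ)+1) = ((n:ℝ)+1) * s + 1 := by
        have := (hn n).ne'
        field_simp
      rw [div_le_iff₀ (hn n), e]
      have := Nat.floor_le (mul_nonneg (hn n).le h0)
      linarith
    refine tendsto_nhdsWithin_iff.2 ⟨?_, Eventually.of_forall hlo⟩
    refine tendsto_of_tendsto_of_tendsto_of_le_of_le tendsto_const_nhds ?_ hlo hhi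
    have := (tendsto_const_nhds (x := s)).add (tendsto_one_div_add_atTop_nhds_zero_nat (𝕜 := ℝ))
    rwa [add_zero] at this

lemma cadlag_integrableOn (f : ℝ → ℝ) (hf : IsCadlag f) (T : ℝ) :
    IntegrableOn f (Icc 0 T) := by
  have hm : AEStronglyMeasurable f (volume.restrict (Ici 0)) := by
    refine (cadlag_aesm f hf).aestronglyMeasurable.congr ?_
    filter_upwards [ae_restrict_mem measurableSet_Ici] with t ht
    rw [max_eq_left ht]
  have hl : LocallyIntegrableOn f (Ici 0) := by
    intro t ht
    have key : ∀ (s : Set ℝ) (l : ℝ), s ⊆ Ici 0 → MeasurableSet s →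
        Tendsto f (nhdsWithin t s) (nhds l) → IntegrableAtFilter f (nhdsWithin t s) := by
      intro s l hs hms h
      have := hms.nhdsWithin_isMeasurablyGenerated t
      refine Measure.FiniteAtFilter.integrableAtFilter_of_tendsto
        ?_ (Measure.finiteAt_nhdsWithin volume t s) h
      exact ⟨s, self_mem_nhdsWithin, hm.mono_measure (Measure.restrict_mono hs le_rfl)⟩
    have h1 := key (Ici t) (f t) (Ici_subset_Ici.2 ht) measurableSet_Ici (hf.1 t ht)
    rcases (show (0:ℝ) ≤ t from ht).eq_or_lt with h0 | h0
    · rw [← h0] at h1 ⊢; exact h1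
    · obtain ⟨l, hl⟩ := hf.2 t h0
      have h2 := key (Ico 0 t) l (fun u hu => hu.1) measurableSet_Ico hl
      have : Ici (0:ℝ) = Ico 0 t ∪ Ici t := (Ico_union_Ici_eq_Ici ht).symm
      rw [this, nhdsWithin_union]
      exact IntegrableAtFilter.sup_iff.2 ⟨h2, h1⟩
  exact hl.integrableOn_compact_subset Icc_subset_Ici_self isCompact_Icc

lemma cadlag_ii (f : ℝ → ℝ) (hf : IsCadlag f) (T : ℝ) (hT : 0 ≤ T) :
    IntervalIntegrable f volume 0 T :=
  (intervalIntegrable_iff_integrableOn_Icc_of_le hT).2 (cadlag_integrableOn f hf T)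

lemma ii_pos {x : ℝ → ℝ} {a b : ℝ} (hx : IntervalIntegrable x volume a b) :
    IntervalIntegrable (fun u => max (x u) 0) volume a b := by
  constructor
  · exact hx.1.pos_part
  · exact hx.2.pos_part

lemma step_bound {x y : ℝ → ℝ} {T K t : ℝ} (hK : 0 ≤ K)
    (hx : IntervalIntegrable x volume 0 t) (hy : IntervalIntegrable y volume 0 t)
    (h : ∀ u, 0 ≤ u → u ≤ T → |x u - y u| ≤ K * Real.exp (2 * u)) (h0 : 0 ≤ t) (ht : t ≤ T) :
    |(∫ u in (0:ℝ)..t, max (x u) 0) - ∫ u in (0:ℝ)..t, max (y u) 0|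
      ≤ K / 2 * Real.exp (2 * t) := by
  rw [← intervalIntegral.integral_sub (ii_pos hx) (ii_pos hy)]
  have hd : ∀ u : ℝ, HasDerivAt (fun u => K / 2 * Real.exp (2 * u)) (K * Real.exp (2 * u)) u := by
    intro u
    have := (((hasDerivAt_id u).const_mul 2).exp).const_mul (K/2)
    refine this.congr_deriv ?_
    simp only [id, mul_one]
    ring
  have hc : Continuous (fun u : ℝ => K * Real.exp (2 * u)) := by fun_prop
  have hi := intervalIntegral.integral_eq_sub_of_hasDerivAt (a := 0) (b := t) (fun u _ => hd u)
    (hc.intervalIntegrable _ _)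
  have := intervalIntegral.norm_integral_le_of_norm_le (μ := volume) (a := 0) (b := t) h0
    (f := fun u => max (x u) 0 - max (y u) 0) (g := fun u => K * Real.exp (2 * u)) ?_
    (hc.intervalIntegrable _ _)
  · rw [hi, Real.norm_eq_abs] at this
    have h3 : 0 ≤ K / 2 * Real.exp (2 * 0) := by positivity
    linarith
  · refine Eventually.of_forall fun u hu => ?_
    rw [Real.norm_eq_abs]
    exact (abs_max_sub_max_le_abs _ _ _).trans (h u hu.1.le (hu.2.trans ht))

lemma sol_unique (f x y : ℝ → ℝ) (hx : IsCadlag x) (hy : IsCadlag y)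
    (ex : ∀ t : ℝ, 0 ≤ t → x t = f t - ∫ u in (0:ℝ)..t, max (x u) 0)
    (ey : ∀ t : ℝ, 0 ≤ t → y t = f t - ∫ u in (0:ℝ)..t, max (y u) 0)
    (T : ℝ) (hT : 0 ≤ T) : y T = x T := by
  have hix := cadlag_ii x hx
  have hiy := cadlag_ii y hy
  obtain ⟨K, hK, hb⟩ : ∃ K : ℝ, 0 ≤ K ∧ ∀ u, 0 ≤ u → u ≤ T →
      |y u - x u| ≤ K * Real.exp (2 * u) := by
    refine ⟨∫ u in (0:ℝ)..T, |max (x u) 0 - max (y u) 0|,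
      intervalIntegral.integral_nonneg hT (fun _ _ => abs_nonneg _), fun u h0 hu => ?_⟩
    rw [ex u h0, ey u h0]
    have e : (f u - ∫ u in (0:ℝ)..u, max (y u) 0) - (f u - ∫ u in (0:ℝ)..u, max (x u) 0)
      = ∫ v in (0:ℝ)..u, (max (x v) 0 - max (y v) 0) := by
      rw [intervalIntegral.integral_sub (ii_pos (hix u h0)) (ii_pos (hiy u h0))]; ring
    rw [e]
    have hint := ((ii_pos (hix T hT)).sub (ii_pos (hiy T hT))).abs
    have h1 := intervalIntegral.abs_integral_le_integral_abs (μ := volume)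
      (f := fun v => max (x v) 0 - max (y v) 0) h0
    have h2 : ∫ v in (0:ℝ)..u, |max (x v) 0 - max (y v) 0| ≤
        ∫ v in (0:ℝ)..T, |max (x v) 0 - max (y v) 0| :=
      intervalIntegral.integral_mono_interval le_rfl h0 hu
        (Eventually.of_forall fun _ => abs_nonneg _) hint
    refine (h1.trans h2).trans (le_mul_of_one_le_right ?_ (Real.one_le_exp (by linarith)))
    exact intervalIntegral.integral_nonneg hT (fun _ _ => abs_nonneg _)
  have hn : ∀ n : ℕ, ∀ u, 0 ≤ u → u ≤ T → |y u - x u| ≤ K / 2 ^ n * Real.exp (2 * u) := by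
    intro n
    induction n with
    | zero => simpa using hb
    | succ n ih =>
      intro u h0 hu
      have := step_bound (by positivity) (hiy u h0) (hix u h0) ih h0 hu
      rw [ex u h0, ey u h0, pow_succ, ← div_div, abs_sub_comm]
      convert this using 2
      ring
  have hlim : Tendsto (fun n : ℕ => K / 2 ^ n * Real.exp (2 * T)) atTop (nhds 0) := by
    have := (tendsto_pow_atTop_nhds_zero_of_lt_one (r := (1/2:ℝ)) (by norm_num)
      (by norm_num)).const_mul (K * Real.exp (2*T))
    rw [mul_zero] at this
    refine this.congr fun n => ?_
    rw [one_div, inv_pow]; field_simp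
  have h := ge_of_tendsto' hlim (fun n => hn n T hT le_rfl)
  exact sub_eq_zero.1 (abs_eq_zero.1 (le_antisymm h (abs_nonneg _)))

noncomputable def pic (g : ℝ → ℝ) : ℕ → ℝ → ℝ
  | 0 => fun _ => 0
  | n + 1 => fun t => ∫ u in (0:ℝ)..t, max (g u - pic g n u) 0

lemma pic_cont (g : ℝ → ℝ) (hg : ∀ a b, IntervalIntegrable g volume a b) (n : ℕ) :
    Continuous (pic g n) := by
  induction n with
  | zero => exact continuous_const
  | succ n ih =>
    exact intervalIntegral.continuous_primitive
      (fun a b => ii_pos ((hg a b).sub (ih.intervalIntegrable a b))) 0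

lemma pic_nonneg (g : ℝ → ℝ) (n : ℕ) (t : ℝ) (ht : 0 ≤ t) : 0 ≤ pic g n t := by
  cases n with
  | zero => exact le_rfl
  | succ n => exact intervalIntegral.integral_nonneg ht (fun _ _ => le_max_right _ _)

lemma pic_tendsto (g : ℝ → ℝ) (hg : ∀ a b, IntervalIntegrable g volume a b)
    (T : ℝ) (hT : 0 ≤ T) : ∃ a, Tendsto (fun n => pic g n T) atTop (nhds a) := by
  obtain ⟨K, hK, hb⟩ : ∃ K : ℝ, 0 ≤ K ∧ ∀ u, 0 ≤ u → u ≤ T →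
      |pic g 0 u - pic g 1 u| ≤ K * Real.exp (2 * u) := by
    obtain ⟨K, hK⟩ := isCompact_Icc.exists_bound_of_continuousOn (s := Icc 0 T)
      ((pic_cont g hg 0).sub (pic_cont g hg 1)).continuousOn
    have hK0 : 0 ≤ K := (norm_nonneg _).trans (hK 0 ⟨le_rfl, hT⟩)
    exact ⟨K, hK0, fun u h0 hu => (hK u ⟨h0, hu⟩).trans
      (le_mul_of_one_le_right hK0 (Real.one_le_exp (by linarith)))⟩
  have hn : ∀ n : ℕ, ∀ u, 0 ≤ u → u ≤ T →
      |pic g n u - pic g (n+1) u| ≤ K / 2 ^ n * Real.exp (2 * u) := by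
    intro n
    induction n with
    | zero => simpa using hb
    | succ n ih =>
      intro u h0 hu
      rw [pow_succ, ← div_div]
      refine step_bound (x := fun u => g u - pic g n u) (y := fun u => g u - pic g (n+1) u)
        (by positivity) ((hg _ _).sub ((pic_cont g hg _).intervalIntegrable _ _))
        ((hg _ _).sub ((pic_cont g hg _).intervalIntegrable _ _)) ?_ h0 hu
      intro v h0 hv
      have := ih v h0 hv
      rw [abs_sub_comm] at this
      convert this using 2
      ring
  refine cauchySeq_tendsto_of_complete
    (cauchySeq_of_le_geometric (1/2) (K * Real.exp (2*T)) (by norm_num) fun n => ?_)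
  rw [Real.dist_eq]
  refine (hn n T hT le_rfl).trans (le_of_eq ?_)
  rw [one_div, inv_pow]; field_simp

lemma sol_exists (f : ℝ → ℝ) (hf : IsCadlag f) :
    ∃ x : ℝ → ℝ,
      (IsCadlag x ∧ ∀ t : ℝ, 0 ≤ t → x t = f t - ∫ u in (0:ℝ)..t, max (x u) 0) := by
  set g : ℝ → ℝ := (Ici 0).indicator f with hgdef
  have hg0 : ∀ u, 0 ≤ u → g u = f u := fun u hu => indicator_of_mem (s := Ici 0) hu f
  have hgi : ∀ a b, IntervalIntegrable g volume a b := by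
    intro a b
    rw [intervalIntegrable_iff]
    have : IntegrableOn g (Iic (max a b)) := by
      rw [IntegrableOn, hgdef, integrable_indicator_iff measurableSet_Ici, IntegrableOn,
        Measure.restrict_restrict measurableSet_Ici]
      exact cadlag_integrableOn f hf _
    exact this.mono_set (fun u hu => hu.2)
  choose! A hA using pic_tendsto g hgi
  set B : ℝ → ℝ := fun t => A (max t 0) with hB
  have hBA : ∀ t, 0 ≤ t → B t = A t := fun t ht => by simp [hB, max_eq_left ht]
  have hBm : Measurable B := by
    refine measurable_of_tendsto_metrizable (f := fun n t => pic g n (max t 0)) ?_ ?_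
    · intro n
      exact ((pic_cont g hgi n).comp (by fun_prop)).measurable
    · rw [tendsto_pi_nhds]
      exact fun t => hA _ (le_max_right _ _)
  have hB0 : ∀ t, 0 ≤ B t := fun t => 
    ge_of_tendsto' (hA _ (le_max_right _ _)) (fun n => pic_nonneg g n _ (le_max_right _ _))
  have hbd : ∀ a c : ℝ, 0 ≤ c → ‖max (a - c) 0‖ ≤ ‖a‖ := by
    intro a c hc
    rw [Real.norm_eq_abs, Real.norm_eq_abs, abs_of_nonneg (le_max_right _ _)]
    exact max_le (by linarith [le_abs_self a]) (abs_nonneg _)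
  have hint : ∀ a b, IntervalIntegrable (fun u => max (g u - B u) 0) volume a b := by
    intro a b
    refine (hgi a b).mono_fun ?_ (Eventually.of_forall fun u => hbd _ _ (hB0 u))
    have h1 : AEStronglyMeasurable g (volume.restrict (uIoc a b)) :=
      (intervalIntegrable_iff.1 (hgi a b)).aestronglyMeasurable
    exact (((h1.aemeasurable.sub hBm.aemeasurable)).max aemeasurable_const).aestronglyMeasurable
  have hc := intervalIntegral.continuous_primitive hint 0
  have hfix : ∀ t, 0 ≤ t → B t = ∫ u in (0:ℝ)..t, max (g u - B u) 0 := by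
    intro t ht
    rw [hBA t ht]
    refine tendsto_nhds_unique ((hA t ht).comp (tendsto_add_atTop_nat 1)) ?_
    refine intervalIntegral.tendsto_integral_filter_of_dominated_convergence
      (F := fun n u => max (g u - pic g n u) 0) (fun u => ‖g u‖) ?_ ?_ (hgi 0 t).norm ?_
    · refine Eventually.of_forall fun n => ?_
      exact (intervalIntegrable_iff.1 (ii_pos ((hgi 0 t).sub
        ((pic_cont g hgi n).intervalIntegrable 0 t)))).aestronglyMeasurable
    · refine Eventually.of_forall fun n => Eventually.of_forall fun u hu => ?_
      rw [uIoc_of_le ht] at hu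
      exact hbd _ _ (pic_nonneg g n u hu.1.le)
    · refine Eventually.of_forall fun u hu => ?_
      rw [uIoc_of_le ht] at hu
      rw [hBA u hu.1.le]
      exact (tendsto_const_nhds.sub (hA u hu.1.le)).max tendsto_const_nhds
  refine ⟨fun t => f t - ∫ u in (0:ℝ)..t, max (g u - B u) 0, ⟨fun t ht => ?_, fun t ht => ?_⟩,
    fun t ht => ?_⟩
  · exact (hf.1 t ht).sub hc.continuousWithinAt
  · obtain ⟨l, hl⟩ := hf.2 t ht
    exact ⟨_, hl.sub (hc.continuousWithinAt (s := Ico 0 t) (x := t))⟩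
  · simp only
    congr 1
    refine intervalIntegral.integral_congr fun u hu => ?_
    rw [uIcc_of_le ht] at hu
    show max (g u - B u) 0 = max (f u - ∫ v in (0:ℝ)..u, max (g v - B v) 0) 0
    rw [← hfix u hu.1, hg0 u hu.1]

/-- For every càdlàg `f` there is a unique (on `[0, ∞)`) càdlàg `x` with
`x t = f t - ∫₀ᵗ x(u)⁺ du` for all `t ≥ 0`. -/
theorem exists_unique_cadlag_solution_pos_part (f : ℝ → ℝ) (hf : IsCadlag f) :
    ∃ x : ℝ → ℝ,
      (IsCadlag x ∧ ∀ t : ℝ, 0 ≤ t → x t = f t - ∫ u in (0:ℝ)..t, max (x u) 0) ∧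
      ∀ y : ℝ → ℝ,
        (IsCadlag y ∧ ∀ t : ℝ, 0 ≤ t → y t = f t - ∫ u in (0:ℝ)..t, max (y u) 0) →
        ∀ t : ℝ, 0 ≤ t → y t = x t := by
  obtain ⟨x, hx, ex⟩ := sol_exists f hf
  exact ⟨x, ⟨hx, ex⟩, fun y hy t ht => sol_unique f x y hx hy.1 ex hy.2 t ht⟩
end

section
/- Let f₁, f₂ : [0,∞) → ℝ be càdlàg and let x₁, x₂ be the (unique) càdlàg solutions of xᵢ(t) = fᵢ(t) − ∫₀ᵗ xᵢ(u)⁺ du for all t ≥ 0 (i = 1, 2). Then for every T ≥ 0, sup_{0 ≤ t ≤ T} |x₁(t) − x₂(t)| ≤ e^{T} · sup_{0 ≤ t ≤ T} |f₁(t) − f₂(t)|; in particular the solution map f ↦ x is continuous with respect to uniform convergence on compact intervals. -/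
open MeasureTheory Set Filter

theorem IsCadlag.bdd {f : ℝ → ℝ} (hf : IsCadlag f) (T : ℝ) :
    ∃ C : ℝ, ∀ t ∈ Set.Icc (0:ℝ) T, |f t| ≤ C := by
  refine (isCompact_Icc (a := (0:ℝ)) (b := T)).induction_on
    (p := fun s => ∃ C : ℝ, ∀ t ∈ s, |f t| ≤ C) ⟨0, by simp⟩ ?_ ?_ ?_
  · rintro s t hst ⟨C, hC⟩
    exact ⟨C, fun u hu => hC u (hst hu)⟩
  · rintro s t ⟨C, hC⟩ ⟨D, hD⟩
    refine ⟨max C D, ?_⟩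
    rintro u (hu | hu)
    · exact (hC u hu).trans (le_max_left _ _)
    · exact (hD u hu).trans (le_max_right _ _)
  · intro t ht
    have hr : ∃ C : ℝ, ∀ᶠ u in nhdsWithin t (Set.Ici t), |f u| ≤ C :=
      ⟨|f t| + 1, ((hf.1 t ht.1).abs.tendsto.eventually (Iic_mem_nhds (lt_add_one _)))⟩
    have hl : ∃ C : ℝ, ∀ᶠ u in nhdsWithin t (Set.Ico 0 t), |f u| ≤ C := by
      rcases ht.1.eq_or_lt with h | h
      · subst h
        exact ⟨0, by simp⟩
      · obtain ⟨l, hl⟩ := hf.2 t h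
        exact ⟨|l| + 1, hl.abs.eventually (Iic_mem_nhds (lt_add_one _))⟩
    obtain ⟨C, hC⟩ := hr
    obtain ⟨D, hD⟩ := hl
    have hsub : nhdsWithin t (Set.Icc 0 T) ≤ nhdsWithin t (Set.Ico 0 t ∪ Set.Ici t) := by
      apply nhdsWithin_mono
      intro u hu
      rcases lt_or_ge u t with h | h
      · exact Or.inl ⟨hu.1, h⟩
      · exact Or.inr h
    rw [nhdsWithin_union] at hsub
    refine ⟨{u | |f u| ≤ max C D}, hsub ?_, max C D, fun u hu => hu⟩
    refine Filter.mem_sup.2 ⟨?_, ?_⟩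
    · filter_upwards [hD] with u hu using hu.trans (le_max_right _ _)
    · filter_upwards [hC] with u hu using hu.trans (le_max_left _ _)

theorem measurable_of_rightCont {g : ℝ → ℝ}
    (hg : ∀ t, ContinuousWithinAt g (Set.Ici t) t) : Measurable g := by
  let a : ℕ → ℝ → ℝ := fun n t => ((⌊((n:ℝ)+1) * t⌋ : ℝ) + 1) / ((n:ℝ)+1)
  have ha1 : ∀ n t, t ≤ a n t := by
    intro n t
    have hn : (0:ℝ) < (n:ℝ) + 1 := by positivity
    rw [le_div_iff₀ hn]
    have := Int.lt_floor_add_one (((n:ℝ)+1) * t)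
    linarith
  have ha2 : ∀ n t, a n t ≤ t + 1 / ((n:ℝ)+1) := by
    intro n t
    have hn : (0:ℝ) < (n:ℝ) + 1 := by positivity
    rw [div_le_iff₀ hn, add_mul t, one_div, inv_mul_cancel₀ hn.ne']
    have := Int.floor_le (((n:ℝ)+1) * t)
    linarith
  refine measurable_of_tendsto_metrizable (f := fun n t => g (a n t)) ?_ ?_
  · intro n
    have h1 : Measurable (fun k : ℤ => g (((k:ℝ) + 1) / ((n:ℝ)+1))) := measurable_of_countable _
    exact h1.comp (Int.measurable_floor.comp (measurable_const_mul _))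
  · rw [tendsto_pi_nhds]
    intro t
    refine (hg t).tendsto.comp (tendsto_nhdsWithin_iff.2 ⟨?_, ?_⟩)
    · refine tendsto_of_tendsto_of_tendsto_of_le_of_le tendsto_const_nhds ?_
        (fun n => ha1 n t) (fun n => ha2 n t)
      simpa using (tendsto_one_div_add_atTop_nhds_zero_nat (𝕜 := ℝ)).const_add t
    · exact Eventually.of_forall fun n => ha1 n t

theorem IsCadlag.rightCont {f : ℝ → ℝ} (hf : IsCadlag f) (t : ℝ) :
    ContinuousWithinAt (fun u => f (max u 0)) (Set.Ici t) t := by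
  refine ContinuousWithinAt.comp (t := Set.Ici (max t 0)) (hf.1 _ (le_max_right _ _)) ?_ ?_
  · fun_prop
  · intro u hu
    exact max_le_max_right _ (Set.mem_Ici.1 hu)

theorem intervalIntegrable_aux {g : ℝ → ℝ} (hm : Measurable g) {t C : ℝ} (ht : 0 ≤ t)
    (hC : ∀ u ∈ Set.Icc (0:ℝ) t, |g u| ≤ C) : IntervalIntegrable g volume 0 t := by
  rw [intervalIntegrable_iff_integrableOn_Icc_of_le ht]
  refine Measure.integrableOn_of_bounded (M := C) (by simp) hm.aestronglyMeasurable ?_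
  exact (ae_restrict_iff' measurableSet_Icc).2 (Eventually.of_forall hC)

/-- Lipschitz-type estimate for the map `f ↦ x`, where `x` solves
`x t = f t - ∫₀ᵗ x(u)⁺ du`: for every `T ≥ 0`,
`sup_{0 ≤ t ≤ T} |x₁ t - x₂ t| ≤ e^T · sup_{0 ≤ t ≤ T} |f₁ t - f₂ t|`. -/
theorem cadlag_solution_pos_part_continuous_dependence
    (f₁ f₂ x₁ x₂ : ℝ → ℝ) (hf₁ : IsCadlag f₁) (hf₂ : IsCadlag f₂)
    (hx₁ : IsCadlag x₁) (hx₂ : IsCadlag x₂)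
    (heq₁ : ∀ t : ℝ, 0 ≤ t → x₁ t = f₁ t - ∫ u in (0:ℝ)..t, max (x₁ u) 0)
    (heq₂ : ∀ t : ℝ, 0 ≤ t → x₂ t = f₂ t - ∫ u in (0:ℝ)..t, max (x₂ u) 0) :
    ∀ T : ℝ, 0 ≤ T → ∀ t ∈ Set.Icc (0:ℝ) T,
      |x₁ t - x₂ t| ≤ Real.exp T * ⨆ u : Set.Icc (0:ℝ) T, |f₁ u - f₂ u| := by
  intro T hT
  set M := ⨆ u : Set.Icc (0:ℝ) T, |f₁ u - f₂ u| with hM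
  have hfM : ∀ u ∈ Set.Icc (0:ℝ) T, |f₁ u - f₂ u| ≤ M := by
    obtain ⟨C, hC⟩ := hf₁.bdd T
    obtain ⟨D, hD⟩ := hf₂.bdd T
    intro u hu
    refine le_ciSup (f := fun u : Set.Icc (0:ℝ) T => |f₁ u - f₂ u|) ?_ ⟨u, hu⟩
    refine ⟨C + D, ?_⟩
    rintro _ ⟨v, rfl⟩
    exact (abs_sub _ _).trans (add_le_add (hC v v.2) (hD v v.2))
  have hM0 : 0 ≤ M := (abs_nonneg _).trans (hfM 0 ⟨le_rfl, hT⟩)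
  obtain ⟨C, hC⟩ := hx₁.bdd T
  obtain ⟨D, hD⟩ := hx₂.bdd T
  set y₁ : ℝ → ℝ := fun u => x₁ (max u 0) with hy₁
  set y₂ : ℝ → ℝ := fun u => x₂ (max u 0) with hy₂
  have e₁ : ∀ u, 0 ≤ u → y₁ u = x₁ u := fun u hu => by simp [hy₁, hu]
  have e₂ : ∀ u, 0 ≤ u → y₂ u = x₂ u := fun u hu => by simp [hy₂, hu]
  have m₁ : Measurable y₁ := measurable_of_rightCont hx₁.rightCont
  have m₂ : Measurable y₂ := measurable_of_rightCont hx₂.rightCont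
  have i₁ : ∀ t ∈ Set.Icc (0:ℝ) T, IntervalIntegrable y₁ volume 0 t := fun t ht =>
    intervalIntegrable_aux m₁ ht.1 fun u hu => by
      rw [e₁ u hu.1]; exact hC u ⟨hu.1, hu.2.trans ht.2⟩
  have i₂ : ∀ t ∈ Set.Icc (0:ℝ) T, IntervalIntegrable y₂ volume 0 t := fun t ht =>
    intervalIntegrable_aux m₂ ht.1 fun u hu => by
      rw [e₂ u hu.1]; exact hD u ⟨hu.1, hu.2.trans ht.2⟩
  have p₁ : ∀ t ∈ Set.Icc (0:ℝ) T, IntervalIntegrable (fun u => max (y₁ u) 0) volume 0 t :=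
    fun t ht => intervalIntegrable_aux (C := C) (m₁.max measurable_const) ht.1 fun u hu => by
      have := hC u ⟨hu.1, hu.2.trans ht.2⟩
      rw [e₁ u hu.1, abs_of_nonneg (le_max_right _ _)]
      exact max_le ((le_abs_self _).trans this) ((abs_nonneg _).trans this)
  have p₂ : ∀ t ∈ Set.Icc (0:ℝ) T, IntervalIntegrable (fun u => max (y₂ u) 0) volume 0 t :=
    fun t ht => intervalIntegrable_aux (C := D) (m₂.max measurable_const) ht.1 fun u hu => by
      have := hD u ⟨hu.1, hu.2.trans ht.2⟩
      rw [e₂ u hu.1, abs_of_nonneg (le_max_right _ _)]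
      exact max_le ((le_abs_self _).trans this) ((abs_nonneg _).trans this)
  set d : ℝ → ℝ := fun u => |y₁ u - y₂ u| with hd
  have md : Measurable d := (m₁.sub m₂).abs
  have di : ∀ t ∈ Set.Icc (0:ℝ) T, IntervalIntegrable d volume 0 t := fun t ht =>
    ((i₁ t ht).sub (i₂ t ht)).abs
  have dc : ∀ t, ContinuousWithinAt d (Set.Ici t) t := fun t =>
    ((hx₁.rightCont t).sub (hx₂.rightCont t)).abs
  have key : ∀ t ∈ Set.Icc (0:ℝ) T, d t ≤ M + ∫ u in (0:ℝ)..t, d u := by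
    intro t ht
    have c₁ : ∫ u in (0:ℝ)..t, max (x₁ u) 0 = ∫ u in (0:ℝ)..t, max (y₁ u) 0 := by
      refine intervalIntegral.integral_congr fun u hu => ?_
      rw [uIcc_of_le ht.1] at hu
      simp only [e₁ u hu.1]
    have c₂ : ∫ u in (0:ℝ)..t, max (x₂ u) 0 = ∫ u in (0:ℝ)..t, max (y₂ u) 0 := by
      refine intervalIntegral.integral_congr fun u hu => ?_
      rw [uIcc_of_le ht.1] at hu
      simp only [e₂ u hu.1]
    have h1 : d t = |(f₁ t - f₂ t) - ∫ u in (0:ℝ)..t, (max (y₁ u) 0 - max (y₂ u) 0)| := by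
      rw [intervalIntegral.integral_sub (p₁ t ht) (p₂ t ht)]
      simp only [hd]
      rw [e₁ t ht.1, e₂ t ht.1, heq₁ t ht.1, heq₂ t ht.1, c₁, c₂]
      congr 1
      ring
    have h2 : |∫ u in (0:ℝ)..t, (max (y₁ u) 0 - max (y₂ u) 0)| ≤ ∫ u in (0:ℝ)..t, d u := by
      refine (intervalIntegral.abs_integral_le_integral_abs ht.1).trans ?_
      refine intervalIntegral.integral_mono_on ht.1 ((p₁ t ht).sub (p₂ t ht)).abs (di t ht) ?_
      intro u _
      exact abs_max_sub_max_le_abs _ _ _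
    rw [h1]
    exact (abs_sub _ _).trans (add_le_add (hfM t ht) h2)
  intro t ht
  have hder : ∀ s ∈ Set.Ico (0:ℝ) T,
      HasDerivWithinAt (fun t => ∫ u in (0:ℝ)..t, d u) (d s) (Set.Ici s) s := fun s hs =>
    intervalIntegral.integral_hasDerivWithinAt_right (t := Set.Ioi s) (di s ⟨hs.1, hs.2.le⟩)
      md.stronglyMeasurable.stronglyMeasurableAtFilter ((dc s).mono Ioi_subset_Ici_self)
  have hcont : ContinuousOn (fun t => ∫ u in (0:ℝ)..t, d u) (Set.Icc 0 T) := by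
    have := intervalIntegral.continuousOn_primitive_interval' (di T ⟨hT, le_rfl⟩)
      (left_mem_uIcc)
    rwa [uIcc_of_le hT] at this
  have G := le_gronwallBound_of_liminf_deriv_right_le (δ := 0) (K := 1) (ε := M) hcont
    (f' := d) (fun s hs r hr => (hder s hs).liminf_right_slope_le hr) (by simp)
    (fun s hs => by have := key s ⟨hs.1, hs.2.le⟩; linarith) t ht
  rw [gronwallBound_of_K_ne_0 one_ne_zero] at G
  have hk := key t ht
  have hdt : d t = |x₁ t - x₂ t| := by simp only [hd]; rw [e₁ t ht.1, e₂ t ht.1]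
  have hexp : Real.exp t * M ≤ Real.exp T * M :=
    mul_le_mul_of_nonneg_right (Real.exp_le_exp.2 ht.2) hM0
  rw [← hdt]
  simp only [sub_zero, one_mul, zero_mul, zero_add, div_one] at G
  linarith
end

section
/- Almost surely, for every T > 0, sup_{0 ≤ t ≤ T} | (n γₙ)^{−1} Bₙ(γₙ t) − μ t | → 0 as n → ∞; that is, the fluid-scaled superposition processes B̄ₙ(t) = (n γₙ)^{−1} Bₙ(γₙ t) converge almost surely, uniformly on compact intervals, to the function t ↦ μ t. -/
open MeasureTheory ProbabilityTheory Set Filter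

noncomputable def ps (x : ℕ → ℝ) (k : ℕ) : ℝ := ∑ i ∈ Finset.range k, x i

noncomputable def cnt (x : ℕ → ℝ) (m : ℝ) : ENNReal :=
  ⨆ k : ℕ, if ps x k ≤ m then (k : ENNReal) else 0

noncomputable def UU (μ : ℝ) (L : ℕ) (x : ℕ → ℝ) : ENNReal :=
  ⨆ m : ℕ, ENNReal.ofReal |(cnt x ((L + m + 1 : ℕ) : ℝ)).toReal / ((L + m + 1 : ℕ) : ℝ) - μ|

lemma measurable_ps (k : ℕ) : Measurable (fun x : ℕ → ℝ => ps x k) := by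
  unfold ps; fun_prop

lemma measurable_cnt (m : ℝ) : Measurable (fun x : ℕ → ℝ => cnt x m) := by
  unfold cnt
  refine Measurable.iSup fun k => ?_
  exact Measurable.ite (measurableSet_le (measurable_ps k) measurable_const)
    measurable_const measurable_const

lemma measurable_UU (μ : ℝ) (L : ℕ) : Measurable (UU μ L) := by
  unfold UU
  refine Measurable.iSup fun m => ?_
  have := (measurable_cnt ((L + m + 1 : ℕ) : ℝ)).ennreal_toReal
  refine ENNReal.measurable_ofReal.comp ?_
  exact ((this.div_const _).sub_const _).abs

lemma UU_anti (μ : ℝ) (L : ℕ) (x : ℕ → ℝ) : UU μ L x ≤ UU μ 0 x := by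
  unfold UU
  refine iSup_le fun m => ?_
  refine le_iSup_of_le (L + m) ?_
  simp

lemma cnt_eq (x : ℕ → ℝ) (m : ℝ) (hm : 0 ≤ m) (hb : BddAbove {k : ℕ | ps x k ≤ m}) :
    cnt x m = ((sSup {k : ℕ | ps x k ≤ m} : ℕ) : ENNReal) := by
  have hne : {k : ℕ | ps x k ≤ m}.Nonempty := ⟨0, by simpa [ps] using hm⟩
  apply le_antisymm
  · refine iSup_le fun k => ?_
    split_ifs with h
    · exact_mod_cast le_csSup hb h
    · simp
  · have h : ps x (sSup {k : ℕ | ps x k ≤ m}) ≤ m := Nat.sSup_mem hne hb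
    refine le_iSup_of_le (sSup {k : ℕ | ps x k ≤ m}) ?_
    rw [if_pos h]

lemma detA_top (μ : ℝ) (hμ : 0 < μ) (x : ℕ → ℝ)
    (hlim : Tendsto (fun k : ℕ => ps x k / k) atTop (nhds (1 / μ))) (m : ℝ) :
    BddAbove {k : ℕ | ps x k ≤ m} := by
  have h1 : Tendsto (fun k : ℕ => ps x k) atTop atTop := by
    have := hlim.pos_mul_atTop (by positivity) (tendsto_natCast_atTop_atTop (R := ℝ))
    refine this.congr' ?_
    filter_upwards [eventually_gt_atTop 0] with k hk
    have : (k : ℝ) ≠ 0 := by positivity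
    field_simp
  obtain ⟨K, hK⟩ := eventually_atTop.1 (h1.eventually_gt_atTop m)
  refine ⟨K, fun k hk => ?_⟩
  by_contra hlt
  have := hK k (by omega)
  simp only [mem_ofPred_eq] at hk
  linarith

lemma detA (μ : ℝ) (hμ : 0 < μ) (x : ℕ → ℝ)
    (hlim : Tendsto (fun k : ℕ => ps x k / k) atTop (nhds (1 / μ))) :
    Tendsto (fun m : ℕ => ((sSup {k : ℕ | ps x k ≤ (m : ℝ)} : ℕ) : ℝ) / m) atTop (nhds μ) := by
  have hb := detA_top μ hμ x hlim
  set N : ℕ → ℕ := fun m => sSup {k : ℕ | ps x k ≤ (m : ℝ)} with hN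
  have hle : ∀ m, ps x (N m) ≤ m := fun m =>
    Nat.sSup_mem (s := {k : ℕ | ps x k ≤ (m : ℝ)}) ⟨0, by simp [ps]⟩ (hb m)
  have hlt : ∀ m : ℕ, (m : ℝ) ≤ ps x (N m + 1) := fun m => by
    by_contra h
    have : N m + 1 ≤ N m := le_csSup (hb m) (by simp only [mem_ofPred_eq]; linarith)
    omega
  have hNtop : Tendsto N atTop atTop := by
    refine tendsto_atTop.2 fun k => ?_
    filter_upwards [(tendsto_natCast_atTop_atTop (R := ℝ)).eventually_ge_atTop (ps x k)] with m hm
    exact le_csSup (hb m) hm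
  have h1 : Tendsto (fun m => ps x (N m) / (N m : ℝ)) atTop (nhds (1 / μ)) := hlim.comp hNtop
  have h2 : Tendsto (fun k : ℕ => ps x (k + 1) / (k : ℝ)) atTop (nhds (1 / μ)) := by
    have e1 := hlim.comp (tendsto_add_atTop_nat 1)
    have e2 : Tendsto (fun k : ℕ => ((k + 1 : ℕ) : ℝ) / (k : ℝ)) atTop (nhds 1) := by
      have : Tendsto (fun k : ℕ => 1 + 1 / (k : ℝ)) atTop (nhds (1 + 0)) :=
        tendsto_const_nhds.add tendsto_one_div_atTop_nhds_zero_nat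
      rw [add_zero] at this
      refine this.congr' ?_
      filter_upwards [eventually_gt_atTop 0] with k hk
      have : (k : ℝ) ≠ 0 := by positivity
      push_cast; field_simp
    have := e1.mul e2
    rw [mul_one] at this
    refine this.congr fun k => ?_
    simp only [Function.comp]
    have : ((k + 1 : ℕ) : ℝ) ≠ 0 := by positivity
    field_simp
  have h3 : Tendsto (fun m => ps x (N m + 1) / (N m : ℝ)) atTop (nhds (1 / μ)) := h2.comp hNtop
  have h4 : Tendsto (fun m : ℕ => (m : ℝ) / (N m : ℝ)) atTop (nhds (1 / μ)) := by
    refine tendsto_of_tendsto_of_tendsto_of_le_of_le h1 h3 (fun m => ?_) (fun m => ?_)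
    · exact div_le_div_of_nonneg_right (hle m) (by positivity)
    · exact div_le_div_of_nonneg_right (hlt m) (by positivity)
  have h5 := h4.inv₀ (by positivity)
  simpa using h5

lemma detB (μ : ℝ) (hμ : 0 < μ) (x : ℕ → ℝ)
    (hlim : Tendsto (fun k : ℕ => ps x k / k) atTop (nhds (1 / μ))) :
    Tendsto (fun L => UU μ L x) atTop (nhds 0) ∧ ∀ L, UU μ L x ≠ ⊤ := by
  have hb := detA_top μ hμ x hlim
  have hA := detA μ hμ x hlim
  have hc : ∀ m : ℕ, (cnt x (m : ℝ)).toReal = ((sSup {k : ℕ | ps x k ≤ (m : ℝ)} : ℕ) : ℝ) := by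
    intro m; rw [cnt_eq x m (by positivity) (hb m)]; simp
  have h0 : Tendsto (fun m : ℕ => |(cnt x (m : ℝ)).toReal / m - μ|) atTop (nhds 0) := by
    simp_rw [hc]
    have := (hA.sub_const μ).abs
    simpa using this
  constructor
  · refine ENNReal.tendsto_nhds_zero.2 fun ε hε => ?_
    rcases eq_or_ne ε ⊤ with rfl | htop
    · simp
    have := h0.eventually_le_const (ENNReal.toReal_pos hε.ne' htop)
    obtain ⟨K, hK⟩ := eventually_atTop.1 this
    filter_upwards [eventually_ge_atTop K] with L hL
    refine iSup_le fun m => ?_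
    exact ENNReal.ofReal_le_of_le_toReal (hK _ (by omega))
  · intro L
    obtain ⟨C, hC⟩ := h0.bddAbove_range
    refine ne_top_of_le_ne_top (b := ENNReal.ofReal C) (by simp) ?_
    refine iSup_le fun m => ENNReal.ofReal_le_ofReal ?_
    exact hC ⟨L + m + 1, rfl⟩

lemma detC (μ : ℝ) (hμ : 0 < μ) (x : ℕ → ℝ)
    (hlim : Tendsto (fun k : ℕ => ps x k / k) atTop (nhds (1 / μ))) (L : ℕ) (s : ℝ) (hs : 0 ≤ s) :
    |((sSup {k : ℕ | ps x k ≤ s} : ℕ) : ℝ) - μ * s| ≤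
      (s + (L + 1)) * (UU μ L x).toReal + (L + 1) * μ := by
  have hb := detA_top μ hμ x hlim
  have hfin := (detB μ hμ x hlim).2 L
  set u := (UU μ L x).toReal with hu
  have hu0 : 0 ≤ u := ENNReal.toReal_nonneg
  set N : ℝ → ℕ := fun m => sSup {k : ℕ | ps x k ≤ m} with hN
  have hmono : ∀ a b : ℝ, 0 ≤ a → a ≤ b → (N a : ℝ) ≤ N b := by
    intro a b ha hab
    have : N a ≤ N b := csSup_le_csSup (hb b) ⟨0, by simpa [ps] using ha⟩
      (fun k hk => le_trans hk hab)
    exact_mod_cast this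
  have key : ∀ m : ℕ, L + 1 ≤ m → |(N m : ℝ) - μ * m| ≤ m * u := by
    intro m hm
    obtain ⟨d, rfl⟩ : ∃ d, m = L + d + 1 := ⟨m - (L + 1), by omega⟩
    have h1 : ENNReal.ofReal |(cnt x ((L + d + 1 : ℕ) : ℝ)).toReal / ((L + d + 1 : ℕ) : ℝ) - μ|
        ≤ UU μ L x := le_iSup (fun m : ℕ => ENNReal.ofReal
          |(cnt x ((L + m + 1 : ℕ) : ℝ)).toReal / ((L + m + 1 : ℕ) : ℝ) - μ|) d
    rw [ENNReal.ofReal_le_iff_le_toReal hfin, cnt_eq x _ (by positivity) (hb _)] at h1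
    have hp : (0:ℝ) < ((L + d + 1 : ℕ) : ℝ) := by positivity
    generalize ((L + d + 1 : ℕ) : ℝ) = q at *
    have h2 : (N q : ℝ) - μ * q = q * ((N q : ℝ) / q - μ) := by field_simp
    rw [h2, abs_mul, abs_of_pos hp]
    exact mul_le_mul_of_nonneg_left (by simpa using h1) hp.le
  have hL0 : (0:ℝ) ≤ L := by positivity
  change |(N s : ℝ) - μ * s| ≤ _
  rcases lt_or_ge s (L + 1) with h | h
  · have h1 := hmono s ((L + 1 : ℕ) : ℝ) hs (by push_cast; linarith)
    have h2 := (abs_le.1 (key (L + 1) le_rfl)).2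
    have h3 : (0:ℝ) ≤ N s := by positivity
    push_cast at h1 h2
    have h4 := mul_nonneg hs hu0
    have h5 := mul_nonneg hμ.le hs
    have h6 := mul_le_mul_of_nonneg_left h.le hμ.le
    have h7 := mul_nonneg hL0 hu0
    rw [abs_le]; constructor <;> nlinarith
  · set m := ⌊s⌋₊ with hm
    have hmL : L + 1 ≤ m := Nat.le_floor (by push_cast; exact h)
    have hms : (m : ℝ) ≤ s := Nat.floor_le hs
    have hsm : s < m + 1 := Nat.lt_floor_add_one s
    have h1 := hmono m s (by positivity) hms
    have h2 := hmono s ((m + 1 : ℕ) : ℝ) hs (by push_cast; linarith)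
    have h3 := (abs_le.1 (key m hmL)).1
    have h4 := (abs_le.1 (key (m + 1) (by omega))).2
    push_cast at h2 h4
    have h5 := mul_le_mul_of_nonneg_right hms hu0
    have h6 := mul_le_mul_of_nonneg_left hms hμ.le
    have h6' := mul_le_mul_of_nonneg_left hsm.le hμ.le
    have h7 := mul_nonneg hL0 hu0
    have h8 := mul_nonneg hL0 hμ.le
    rw [abs_le]; constructor <;> nlinarith

lemma probD {Ω : Type*} [MeasurableSpace Ω] (P : Measure Ω) [IsProbabilityMeasure P]
    (μ : ℝ) (hμ : 0 < μ) (ν : Measure ℝ) (hmean : ∫ x, x ∂ν = 1 / μ)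
    (X : ℕ → Ω → ℝ) (hmeas : ∀ k, Measurable (X k)) (hind : iIndepFun X P)
    (hd : ∀ k, Measure.map (X (k + 1)) P = ν) :
    ∀ᵐ ω ∂P, Tendsto (fun k : ℕ => ps (fun i => X i ω) k / k) atTop (nhds (1 / μ)) := by
  have hint : Integrable (fun x : ℝ => x) ν := by
    by_contra h
    rw [integral_undef h] at hmean
    have : 0 < 1 / μ := by positivity
    linarith
  have hE : ∫ ω, X 1 ω ∂P = 1 / μ := by
    rw [← hmean, ← hd 0, integral_map (hmeas _).aemeasurable (by fun_prop)]
  have hsl := strong_law_ae_real (μ := P) (fun k => X (k + 1))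
    (by
      have := hint
      rw [← hd 0] at this
      exact this.comp_measurable (hmeas _))
    (fun i j hij => hind.indepFun (by simpa using hij))
    (fun i => ⟨(hmeas _).aemeasurable, (hmeas _).aemeasurable, by rw [hd, hd]⟩)
  filter_upwards [hsl] with ω hω
  rw [hE] at hω
  rw [← tendsto_add_atTop_iff_nat 1]
  have e0 : Tendsto (fun n : ℕ => X 0 ω / (n : ℝ)) atTop (nhds 0) :=
    tendsto_const_div_atTop_nhds_zero_nat _
  have e1 : Tendsto (fun n : ℕ => (n : ℝ) / (n + 1)) atTop (nhds 1) :=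
    tendsto_natCast_div_add_atTop 1
  have := (hω.add e0).mul e1
  rw [add_zero, mul_one] at this
  refine this.congr' ?_
  filter_upwards [eventually_gt_atTop 0] with n hn
  have h1 : (n : ℝ) ≠ 0 := by positivity
  have h2 : (n : ℝ) + 1 ≠ 0 := by positivity
  rw [ps, Finset.sum_range_succ']
  push_cast
  field_simp

noncomputable def WW (a : ℝ) (x : ℕ → ℝ) : ENNReal :=
  ∑' k : ℕ, ENNReal.ofReal ((k + 1) * Real.exp (a * (k + 1))) *
    ∏ i ∈ Finset.range (k + 1), ENNReal.ofReal (Real.exp (-(x i)))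

lemma UU_le (μ : ℝ) (hμ : 0 < μ) (a : ℝ) (ha : 0 < a) (x : ℕ → ℝ) :
    UU μ 0 x ≤ ENNReal.ofReal (1 / a + μ) + WW a x := by
  rcases eq_or_ne (WW a x) ⊤ with htop | htop
  · simp [htop]
  have hc : ∀ m : ℝ, 0 ≤ m → cnt x m ≤ ENNReal.ofReal (m / a) + WW a x := by
    intro m hm
    refine iSup_le fun k => ?_
    split_ifs with h
    · rcases le_or_gt (k : ℝ) (m / a) with hk | hk
      · refine le_add_right ?_
        rw [← ENNReal.ofReal_natCast]
        exact ENNReal.ofReal_le_ofReal hk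
      · refine le_add_left ?_
        cases k with
        | zero => simp
        | succ k =>
          refine le_trans ?_ (ENNReal.le_tsum k)
          rw [← ENNReal.ofReal_prod_of_nonneg (fun i _ => (Real.exp_pos _).le),
            ← ENNReal.ofReal_mul (by positivity), ← Real.exp_sum, ← ENNReal.ofReal_natCast]
          apply ENNReal.ofReal_le_ofReal
          rw [mul_assoc, ← Real.exp_add, Finset.sum_neg_distrib]
          rw [div_lt_iff₀ ha] at hk
          unfold ps at h
          push_cast at hk ⊢
          have : (1:ℝ) ≤ Real.exp (a * (↑k + 1) + -∑ i ∈ Finset.range (k + 1), x i) :=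
            Real.one_le_exp (by linarith)
          have h0 : (0:ℝ) ≤ (k:ℝ) + 1 := by positivity
          nlinarith
    · simp
  refine iSup_le fun d => ?_
  have hm : (1:ℝ) ≤ ((0 + d + 1 : ℕ) : ℝ) := by push_cast; simp
  generalize ((0 + d + 1 : ℕ) : ℝ) = m at hm
  have h1 := ENNReal.toReal_mono (by simp [htop]) (hc m (by linarith))
  rw [ENNReal.toReal_add (by simp) htop, ENNReal.toReal_ofReal (by positivity)] at h1
  have h2 : WW a x = ENNReal.ofReal (WW a x).toReal := (ENNReal.ofReal_toReal htop).symm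
  rw [h2, ← ENNReal.ofReal_add (by positivity) ENNReal.toReal_nonneg]
  apply ENNReal.ofReal_le_ofReal
  have h3 : (0:ℝ) ≤ (cnt x m).toReal := ENNReal.toReal_nonneg
  have h4 : (0:ℝ) ≤ (WW a x).toReal := ENNReal.toReal_nonneg
  have h5 : (cnt x m).toReal / m ≤ 1 / a + (WW a x).toReal := by
    rw [div_le_iff₀ (by linarith), add_mul]
    have : m / a = 1 / a * m := by ring
    nlinarith
  have h6 : 0 ≤ (cnt x m).toReal / m := by positivity
  have h7 : 0 < 1 / a := by positivity
  rw [abs_le]; constructor <;> linarith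

lemma rho_lt (μ : ℝ) (hμ : 0 < μ) (ν : Measure ℝ) [IsProbabilityMeasure ν]
    (hsupp : ν (Set.Iio 0) = 0) (hmean : ∫ x, x ∂ν = 1 / μ) :
    ∃ ρ : ℝ, 0 < ρ ∧ ρ < 1 ∧ ∫⁻ x, ENNReal.ofReal (Real.exp (-x)) ∂ν = ENNReal.ofReal ρ := by
  have hnn : ∀ᵐ x ∂ν, 0 ≤ x := by
    rw [ae_iff]; simpa [Set.Iio] using hsupp
  have hint : Integrable (fun x : ℝ => Real.exp (-x)) ν := by
    refine Integrable.of_bound (C := 1) (by fun_prop) ?_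
    filter_upwards [hnn] with x hx
    rw [Real.norm_of_nonneg (Real.exp_pos _).le]
    exact Real.exp_le_one_iff.2 (by linarith)
  refine ⟨∫ x, Real.exp (-x) ∂ν, integral_exp_pos hint, ?_,
    (ofReal_integral_eq_lintegral_ofReal hint (ae_of_all _ fun x => (Real.exp_pos _).le)).symm⟩
  have h1 : ∫ x, (1 - Real.exp (-x)) ∂ν = 1 - ∫ x, Real.exp (-x) ∂ν := by
    rw [integral_sub (integrable_const _) hint]; simp
  have hn : 0 ≤ᵐ[ν] fun x => 1 - Real.exp (-x) := by
    filter_upwards [hnn] with x hx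
    have := Real.exp_le_one_iff.2 (show -x ≤ 0 by linarith)
    simp only [Pi.zero_apply]; linarith
  have h2 := integral_nonneg_of_ae hn
  rcases h2.eq_or_lt with h3 | h3
  · exfalso
    have h4 := (integral_eq_zero_iff_of_nonneg_ae hn ((integrable_const _).sub hint)).1 h3.symm
    have h5 : (fun x : ℝ => x) =ᵐ[ν] 0 := by
      filter_upwards [h4] with x hx
      simp only [Pi.zero_apply] at hx ⊢
      have : Real.exp (-x) = 1 := by linarith
      rw [Real.exp_eq_one_iff] at this
      linarith
    rw [integral_congr_ae h5] at hmean
    simp at hmean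
    linarith
  · linarith

lemma probE {Ω : Type*} [MeasurableSpace Ω] (P : Measure Ω) [IsProbabilityMeasure P]
    (μ : ℝ) (hμ : 0 < μ) (ν : Measure ℝ) [IsProbabilityMeasure ν]
    (hsupp : ν (Set.Iio 0) = 0) (hmean : ∫ x, x ∂ν = 1 / μ)
    (X : ℕ → Ω → ℝ) (hmeas : ∀ k, Measurable (X k)) (hnn : ∀ k ω, 0 ≤ X k ω)
    (hind : iIndepFun X P)
    (hd : ∀ k, Measure.map (X (k + 1)) P = ν) :
    ∫⁻ ω, UU μ 0 (fun i => X i ω) ∂P ≠ ⊤ := by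
  obtain ⟨ρ, hρ0, hρ1, hρ⟩ := rho_lt μ hμ ν hsupp hmean
  set a : ℝ := - Real.log ρ / 2 with ha
  have hlog : Real.log ρ < 0 := Real.log_neg hρ0 hρ1
  have ha0 : 0 < a := by rw [ha]; linarith
  have hr : Real.exp a * ρ < 1 := by
    nth_rewrite 1 [← Real.exp_log hρ0]
    rw [← Real.exp_add, Real.exp_lt_one_iff]
    rw [ha]; linarith
  have hr0 : 0 < Real.exp a * ρ := by positivity
  have hmg : Measurable (fun x : ℝ => ENNReal.ofReal (Real.exp (-x))) := by fun_prop
  have hterm : ∀ k : ℕ, ∫⁻ ω, ∏ i ∈ Finset.range (k + 1), ENNReal.ofReal (Real.exp (-(X i ω))) ∂P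
      ≤ ENNReal.ofReal (ρ ^ k) := by
    intro k
    have hi : iIndepFun (fun i ω => ENNReal.ofReal (Real.exp (-(X i ω)))) P :=
      hind.comp (fun _ => fun x : ℝ => ENNReal.ofReal (Real.exp (-x))) (fun _ => hmg)
    have := lintegral_prod_eq_prod_lintegral_of_indepFun (Finset.range (k + 1))
      (fun i ω => ENNReal.ofReal (Real.exp (-(X i ω)))) hi (fun i => hmg.comp (hmeas i))
    rw [this, Finset.prod_range_succ']
    have e1 : ∀ i, ∫⁻ ω, ENNReal.ofReal (Real.exp (-(X (i + 1) ω))) ∂P = ENNReal.ofReal ρ := by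
      intro i
      rw [← hρ, ← hd i, lintegral_map hmg (hmeas _)]
    have e2 : ∫⁻ ω, ENNReal.ofReal (Real.exp (-(X 0 ω))) ∂P ≤ 1 := by
      calc _ ≤ ∫⁻ ω, 1 ∂P := lintegral_mono fun ω => by
            rw [← ENNReal.ofReal_one]
            exact ENNReal.ofReal_le_ofReal (Real.exp_le_one_iff.2 (by linarith [hnn 0 ω]))
        _ = 1 := by simp
    simp_rw [e1]
    rw [Finset.prod_const, Finset.card_range, ENNReal.ofReal_pow hρ0.le]
    exact (mul_le_mul_right e2 _).trans (by simp)
  have hW : ∫⁻ ω, WW a (fun i => X i ω) ∂P ≠ ⊤ := by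
    unfold WW
    have hmp : ∀ k : ℕ, Measurable (fun ω => ∏ i ∈ Finset.range (k + 1),
        ENNReal.ofReal (Real.exp (-(X i ω)))) := fun k =>
      Finset.measurable_fun_prod _ fun i _ => hmg.comp (hmeas i)
    rw [lintegral_tsum (fun k => ((hmp k).const_mul _).aemeasurable)]
    have hsum : Summable (fun k : ℕ => Real.exp a * ((k : ℝ) * (Real.exp a * ρ) ^ k +
        (Real.exp a * ρ) ^ k)) := by
      refine Summable.mul_left _ (Summable.add ?_ ?_)
      · simpa using summable_pow_mul_geometric_of_norm_lt_one 1
          (r := Real.exp a * ρ) (by rw [Real.norm_of_nonneg hr0.le]; exact hr)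
      · exact summable_geometric_of_lt_one hr0.le hr
    refine ne_top_of_le_ne_top hsum.tsum_ofReal_ne_top (ENNReal.tsum_le_tsum fun k => ?_)
    rw [lintegral_const_mul _ (hmp k)]
    refine (mul_le_mul_right (hterm k) _).trans ?_
    rw [← ENNReal.ofReal_mul (by positivity)]
    apply ENNReal.ofReal_le_ofReal
    apply le_of_eq
    rw [mul_pow, ← Real.exp_nat_mul, mul_add a, Real.exp_add]
    ring_nf
  refine ne_top_of_le_ne_top ?_ (lintegral_mono fun ω => UU_le μ hμ a ha0 (fun i => X i ω))
  rw [lintegral_add_left measurable_const]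
  simp [hW]

lemma det_final (μ : ℝ) (hμ : 0 < μ) (x : ℕ → ℕ → ℝ)
    (hlim : ∀ j, Tendsto (fun k : ℕ => ps (x j) k / k) atTop (nhds (1 / μ)))
    (e : ℕ → ℝ) (he : Tendsto e atTop (nhds 0))
    (havg : ∀ L, Tendsto (fun n : ℕ => (∑ j ∈ Finset.range n, (UU μ L (x j)).toReal) / n) atTop
      (nhds (e L)))
    (γ : ℕ → ℝ) (hγpos : ∀ n, 0 < γ n) (hγ : Tendsto γ atTop atTop) (T : ℝ) (hT : 0 < T) :
    TendstoUniformlyOn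
        (fun (n : ℕ) (t : ℝ) =>
          ((n : ℝ) * γ n)⁻¹ * ∑ j ∈ Finset.range n, ((sSup {k : ℕ | ps (x j) k ≤ γ n * t} : ℕ) : ℝ))
        (fun t => μ * t) atTop (Set.Icc 0 T) := by
  rw [Metric.tendstoUniformlyOn_iff]
  intro ε hε
  obtain ⟨L, hL⟩ : ∃ L, T * e L < ε := by
    have := he.const_mul T
    rw [mul_zero] at this
    exact (this.eventually_lt_const hε).exists
  set A : ℕ → ℝ := fun n : ℕ => (∑ j ∈ Finset.range n, (UU μ L (x j)).toReal) / n with hA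
  have hbd : Tendsto (fun n => (T + (L + 1) / γ n) * A n + ((L + 1) * μ) / γ n) atTop
      (nhds ((T + 0) * e L + 0)) :=
    ((tendsto_const_nhds.add (hγ.const_div_atTop _)).mul (havg L)).add (hγ.const_div_atTop _)
  rw [add_zero, add_zero] at hbd
  filter_upwards [hbd.eventually_lt_const hL, eventually_gt_atTop 0] with n hn hn0 t ht
  refine lt_of_le_of_lt ?_ hn
  have hg := hγpos n
  have hnp : (0:ℝ) < n := by positivity
  have hA0 : 0 ≤ A n := by
    have : 0 ≤ ∑ j ∈ Finset.range n, (UU μ L (x j)).toReal :=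
      Finset.sum_nonneg fun _ _ => ENNReal.toReal_nonneg
    simp only [hA]; positivity
  have hsum : |∑ j ∈ Finset.range n, (((sSup {k : ℕ | ps (x j) k ≤ γ n * t} : ℕ) : ℝ)
      - μ * (γ n * t))| ≤ ∑ j ∈ Finset.range n,
        ((γ n * t + (L + 1)) * (UU μ L (x j)).toReal + (L + 1) * μ) :=
    (Finset.abs_sum_le_sum_abs _ _).trans (Finset.sum_le_sum fun j _ =>
      detC μ hμ (x j) (hlim j) L (γ n * t) (mul_nonneg hg.le ht.1))
  rw [Finset.sum_add_distrib, ← Finset.mul_sum, Finset.sum_const, Finset.card_range,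
    nsmul_eq_mul] at hsum
  have hAn : ∑ j ∈ Finset.range n, (UU μ L (x j)).toReal = n * A n := by
    simp only [hA]; field_simp
  rw [hAn, Finset.sum_sub_distrib, Finset.sum_const, Finset.card_range, nsmul_eq_mul] at hsum
  rw [dist_comm, Real.dist_eq]
  generalize (∑ j ∈ Finset.range n, ((sSup {k : ℕ | ps (x j) k ≤ γ n * t} : ℕ) : ℝ)) = B at *
  have h1 : (n * γ n)⁻¹ * B - μ * t = (n * γ n)⁻¹ * (B - n * (μ * (γ n * t))) := by
    field_simp
  rw [h1, abs_mul, abs_of_pos (by positivity)]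
  calc _ ≤ (n * γ n)⁻¹ * ((γ n * t + (L + 1)) * (n * A n) + n * ((L + 1) * μ)) :=
        mul_le_mul_of_nonneg_left hsum (by positivity)
    _ = (t + (L + 1) / γ n) * A n + ((L + 1) * μ) / γ n := by field_simp
    _ ≤ _ := by
        have := mul_le_mul_of_nonneg_right ht.2 hA0
        nlinarith

lemma block_indep {Ω : Type*} [MeasurableSpace Ω] (P : Measure Ω)
    (Y : ℕ × ℕ → Ω → ℝ) (hmeas : ∀ p, Measurable (Y p)) (hind : iIndepFun Y P)
    (i j : ℕ) (hij : i ≠ j) :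
    IndepFun (fun ω k => Y (i, k) ω) (fun ω k => Y (j, k) ω) P := by
  rw [IndepFun_iff_Indep]
  have h := indep_iSup_of_disjoint (fun p => (hmeas p).comap_le) hind.iIndep
    (S := {p | p.1 = i}) (T := {p | p.1 = j})
    (Set.disjoint_left.2 fun p hp hq => hij (hp.symm.trans hq))
  have key : ∀ i : ℕ, MeasurableSpace.comap (fun ω k => Y (i, k) ω) MeasurableSpace.pi ≤
      ⨆ p ∈ {p : ℕ × ℕ | p.1 = i}, MeasurableSpace.comap (Y p) inferInstance := by
    intro i
    rw [MeasurableSpace.pi, MeasurableSpace.comap_iSup]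
    refine iSup_le fun k => ?_
    rw [MeasurableSpace.comap_comp]
    exact le_iSup₂_of_le (i, k) rfl le_rfl
  exact indep_of_indep_of_le_left (indep_of_indep_of_le_right h (key j)) (key i)

/-- Functional strong law of large numbers for the superposition of time-scaled
stationary renewal processes: almost surely, the fluid-scaled superposition
`B̄ₙ(t) = (n γₙ)⁻¹ Bₙ(γₙ t)` converges uniformly on every compact interval `[0, T]`
to `t ↦ μ t`. -/
theorem fluid_limit_superposition_renewal
    {Ω : Type*} [MeasurableSpace Ω] (P : Measure Ω) [IsProbabilityMeasure P]
    (μ : ℝ) (hμ : 0 < μ)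
    -- `ν` is the interrenewal (service time) distribution, with cdf `F`
    (ν : Measure ℝ) [IsProbabilityMeasure ν] (hsupp : ν (Set.Iio 0) = 0)
    (hmean : ∫ x, x ∂ν = 1 / μ) (hsq : Integrable (fun x => x ^ 2) ν)
    (F : ℝ → ℝ) (hF : ∀ t, F t = (ν (Set.Iic t)).toReal)
    -- `νe` is the equilibrium distribution of `ν`, with density `μ (1 - F)` on `[0, ∞)`
    (νe : Measure ℝ)
    (hνe : νe = MeasureTheory.volume.withDensity fun t =>
      ENNReal.ofReal (Set.indicator (Set.Ici 0) (fun u => μ * (1 - F u)) t))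
    -- the interrenewal times `ξ j k`, `k ≥ 1`: independent, `ξ j 1 ~ νe`, `ξ j k ~ ν` for `k ≥ 2`
    (ξ : ℕ → ℕ → Ω → ℝ)
    (hmeas : ∀ j k, Measurable (ξ j k))
    (hnonneg : ∀ j k ω, 0 ≤ ξ j k ω)
    (hindep : iIndepFun (m := fun _ : ℕ × ℕ => (inferInstance : MeasurableSpace ℝ))
      (fun p : ℕ × ℕ => ξ p.1 (p.2 + 1)) P)
    (hdist1 : ∀ j, Measure.map (ξ j 1) P = νe)
    (hdist : ∀ j k, 2 ≤ k → Measure.map (ξ j k) P = ν)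
    -- partial sums and the stationary renewal processes
    (S : ℕ → ℕ → Ω → ℝ)
    (hS : ∀ j k ω, S j k ω = ∑ i ∈ Finset.range k, ξ j (i + 1) ω)
    (N : ℕ → ℝ → Ω → ℕ)
    (hN : ∀ j t ω, N j t ω = sSup {k : ℕ | S j k ω ≤ t})
    -- the time-scaling factors
    (γ : ℕ → ℝ) (hγpos : ∀ n, 0 < γ n) (hγ : Tendsto γ atTop atTop) :
    ∀ᵐ ω ∂P, ∀ T : ℝ, 0 < T →
      TendstoUniformlyOn
        (fun (n : ℕ) (t : ℝ) =>
          ((n : ℝ) * γ n)⁻¹ * ∑ j ∈ Finset.range n, (N j (γ n * t) ω : ℝ))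
        (fun t => μ * t) atTop (Set.Icc 0 T) := by
  set Y : ℕ × ℕ → Ω → ℝ := fun p => ξ p.1 (p.2 + 1) with hY
  set x : ℕ → Ω → ℕ → ℝ := fun j ω k => ξ j (k + 1) ω with hx
  have hYm : ∀ p, Measurable (Y p) := fun p => hmeas _ _
  have hxm : ∀ j, Measurable (x j) := fun j => measurable_pi_iff.2 fun k => hmeas _ _
  have hrow : ∀ j, iIndepFun (fun k => ξ j (k + 1)) P := fun j =>
    iIndepFun.precomp (g := fun k : ℕ => (j, k)) (fun a b h => by simpa using h) hindep
  have hlaw : ∀ j, Measure.map (x j) P = Measure.map (x 0) P := by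
    intro j
    have h1 := (hrow j).map_fun_eq_infinitePi_map (fun k => hmeas _ _)
    have h2 := (hrow 0).map_fun_eq_infinitePi_map (fun k => hmeas _ _)
    have h3 : (fun k => Measure.map (ξ j (k + 1)) P) = fun k => Measure.map (ξ 0 (k + 1)) P := by
      funext k
      cases k with
      | zero => rw [hdist1, hdist1]
      | succ k => rw [hdist _ _ (by omega), hdist _ _ (by omega)]
    calc Measure.map (x j) P = _ := h1
      _ = _ := by simp only [h3]
      _ = _ := h2.symm
  have hae : ∀ j, ∀ᵐ ω ∂P, Tendsto (fun k : ℕ => ps (x j ω) k / k) atTop (nhds (1 / μ)) :=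
    fun j => probD P μ hμ ν hmean (fun k => ξ j (k + 1)) (fun k => hmeas _ _) (hrow j)
      (fun k => hdist _ _ (by omega))
  have hfin : ∫⁻ ω, UU μ 0 (x 0 ω) ∂P ≠ ⊤ :=
    probE P μ hμ ν hsupp hmean (fun k => ξ 0 (k + 1)) (fun k => hmeas _ _)
      (fun k ω => hnonneg _ _ _) (hrow 0) (fun k => hdist _ _ (by omega))
  have hUm : ∀ L j, Measurable (fun ω => UU μ L (x j ω)) := fun L j =>
    (measurable_UU μ L).comp (hxm j)
  have hfinL : ∀ L, ∫⁻ ω, UU μ L (x 0 ω) ∂P ≠ ⊤ := fun L =>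
    ne_top_of_le_ne_top hfin (lintegral_mono fun ω => UU_anti μ L _)
  have hsl : ∀ L, ∀ᵐ ω ∂P, Tendsto
      (fun n : ℕ => (∑ j ∈ Finset.range n, (UU μ L (x j ω)).toReal) / n) atTop
      (nhds (∫ ω, (UU μ L (x 0 ω)).toReal ∂P)) := by
    intro L
    have hg : Measurable (fun y : ℕ → ℝ => (UU μ L y).toReal) := (measurable_UU μ L).ennreal_toReal
    refine strong_law_ae_real (fun j ω => (UU μ L (x j ω)).toReal)
      (integrable_toReal_of_lintegral_ne_top (hUm L 0).aemeasurable (hfinL L)) ?_ ?_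
    · intro i j hij
      exact (block_indep P Y hYm hindep i j hij).comp hg hg
    · intro j
      have : IdentDistrib (x j) (x 0) P P :=
        ⟨(hxm j).aemeasurable, (hxm 0).aemeasurable, hlaw j⟩
      exact this.comp hg
  have he : Tendsto (fun L => ∫ ω, (UU μ L (x 0 ω)).toReal ∂P) atTop (nhds 0) := by
    have h1 : Tendsto (fun L => ∫⁻ ω, UU μ L (x 0 ω) ∂P) atTop (nhds (∫⁻ _, 0 ∂P)) := by
      refine tendsto_lintegral_of_dominated_convergence (fun ω => UU μ 0 (x 0 ω))
        (fun L => hUm L 0) (fun L => ae_of_all _ fun ω => UU_anti μ L _) hfin ?_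
      filter_upwards [hae 0] with ω hω
      exact (detB μ hμ _ hω).1
    have h2 : ∀ L, ∫ ω, (UU μ L (x 0 ω)).toReal ∂P = (∫⁻ ω, UU μ L (x 0 ω) ∂P).toReal := by
      intro L
      refine integral_toReal (hUm L 0).aemeasurable ?_
      filter_upwards [hae 0] with ω hω
      exact ((detB μ hμ _ hω).2 L).lt_top
    simp_rw [h2]
    have := (ENNReal.tendsto_toReal (by simp)).comp h1
    simpa [Function.comp_def] using this
  filter_upwards [ae_all_iff.2 hae, ae_all_iff.2 hsl] with ω h1 h2 T hT
  have := det_final μ hμ (fun j => x j ω) h1 _ he h2 γ hγpos hγ T hT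
  have hNe : ∀ j t, N j t ω = sSup {k : ℕ | ps (x j ω) k ≤ t} := by
    intro j t
    rw [hN]
    simp only [hS, ps, hx]
  simp_rw [hNe]
  exact this
end
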